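/- Suppose (G_n, c_n), γ_n > 0 and δ_n → 0 satisfy Assumption (EO), the network c_n is connected, and G_n is simple. Then the expected edge overlap of two independent weighted spanning trees satisfies E[|𝒯(c_n) ∩ 𝒯'(c_n)|] = O(δ_n)|V(G_n)|, where 𝒯(c_n), 𝒯'(c_n) are two independent samples of WST(c_n). -/

import Mathlib

open MeasureTheory Filter Finset

noncomputable section

set_option linter.unusedSectionVars false

namespace WSTPaper

variable {V : Type} [Fintype V] [DecidableEq V]

open scoped Classical in
/-- The edge sets of spanning trees of `G`. -/
def spanningTrees (G : SimpleGraph V) : Finset (Finset (Sym2 V)) :=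
  Finset.univ.filter
    (fun T => ↑T ⊆ G.edgeSet ∧ (SimpleGraph.fromEdgeSet (↑T : Set (Sym2 V))).IsTree)

/-- Weight of a spanning tree: product of its edge conductances. -/
def treeWeight (c : Sym2 V → ℝ) (T : Finset (Sym2 V)) : ℝ := ∏ e ∈ T, c e

/-- Partition function of the weighted spanning tree measure. -/
def partZ (G : SimpleGraph V) (c : Sym2 V → ℝ) : ℝ := ∑ T ∈ spanningTrees G, treeWeight c T

/-- The expected number of common edges `E[|𝒯(c) ∩ 𝒯'(c)|]` of two independent samples
`𝒯(c), 𝒯'(c)` of the weighted spanning tree `WST(c)` of the network `(G, c)`. -/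
def overlapDet (G : SimpleGraph V) (c : Sym2 V → ℝ) : ℝ :=
  (∑ T ∈ spanningTrees G, ∑ T' ∈ spanningTrees G,
      treeWeight c T * treeWeight c T' * ((T ∩ T').card : ℝ)) / (partZ G c) ^ 2


/-- The conductance `C_v = Σ_{u ~ v} c(u,v)` of a vertex. -/
def vertCond (G : SimpleGraph V) [DecidableRel G.Adj] (c : Sym2 V → ℝ) (v : V) : ℝ :=
  ∑ u ∈ G.neighborFinset v, c s(u, v)

/-- The edge `xy` of `H` is crossed from `x` to `y` on the way from `u` to `v`: deleting `xy` leaves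
`u` joined to `x` and `y` joined to `v`. -/
def Crosses (H : SimpleGraph V) (u v x y : V) : Prop :=
  H.Adj x y ∧ (H.deleteEdges {s(x, y)}).Reachable u x ∧ (H.deleteEdges {s(x, y)}).Reachable y v

theorem sum_darts_sub {H : SimpleGraph V} (f : V → ℝ) {u v : V} (p : H.Walk u v) :
    (p.darts.map fun d => f d.fst - f d.snd).sum = f u - f v := by
  induction p with
  | nil => simp
  | cons h q ih => simp [ih]

theorem crosses_of_mem_darts {H : SimpleGraph V} {u v : V} {p : H.Walk u v} (hp : p.IsPath)
    {d : H.Dart} (hd : d ∈ p.darts) : Crosses H u v d.fst d.snd := by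
  refine ⟨d.adj, ?_⟩
  induction p with
  | nil => simp at hd
  | @cons u w v h q ih =>
    rw [SimpleGraph.Walk.cons_isPath_iff] at hp
    have huq (z : V) : s(u, z) ∉ q.edges := fun hz =>
      hp.2 (q.fst_mem_support_of_mem_edges hz)
    rw [SimpleGraph.Walk.darts_cons, List.mem_cons] at hd
    rcases hd with rfl | hd
    · exact ⟨.refl _, ⟨q.toDeleteEdge _ (huq w)⟩⟩
    · obtain ⟨h1, h2⟩ := ih hp.1 hd
      refine ⟨SimpleGraph.Reachable.trans (SimpleGraph.Adj.reachable ?_) h1, h2⟩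
      refine SimpleGraph.deleteEdges_adj.2 ⟨h, fun he => huq w ?_⟩
      rw [Set.mem_singleton_iff.1 he]
      exact List.mem_map_of_mem hd

theorem not_reachable_of_isTree {H : SimpleGraph V} (hH : H.IsTree) {x y : V} (h : H.Adj x y) :
    ¬ (H.deleteEdges {s(x, y)}).Reachable x y :=
  SimpleGraph.isBridge_iff.1 (SimpleGraph.isAcyclic_iff_forall_adj_isBridge.1 hH.isAcyclic h)

theorem Crosses.exists_mem_darts {H : SimpleGraph V} (hH : H.IsTree) {u v x y : V}
    {p : H.Walk u v} (hp : p.IsPath) (h : Crosses H u v x y) :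
    ∃ d ∈ p.darts, d.fst = x ∧ d.snd = y := by
  obtain ⟨hxy, h1, h2⟩ := h
  have hbr := not_reachable_of_isTree hH hxy
  have he : s(x, y) ∈ p.edges := by
    by_contra he
    exact hbr (h1.symm.trans (SimpleGraph.Reachable.trans ⟨p.toDeleteEdge _ he⟩ h2.symm))
  obtain ⟨d, hd, hde⟩ := List.mem_map.1 he
  rcases SimpleGraph.dart_edge_eq_mk'_iff'.1 hde with hd' | hd'
  · exact ⟨d, hd, hd'⟩
  · obtain ⟨-, h3, -⟩ := crosses_of_mem_darts hp hd
    rw [hd'.1, hd'.2, Sym2.eq_swap] at h3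
    exact absurd (h1.symm.trans h3) hbr

open scoped Classical in
/-- In a tree, the increments of a potential along the path from `u` to `v` telescope. -/
theorem sum_crosses {H : SimpleGraph V} (hH : H.IsTree) (f : V → ℝ) (u v : V) :
    (∑ x, ∑ y, if Crosses H u v x y then f x - f y else 0) = f u - f v := by
  obtain ⟨p, hp, -⟩ := hH.existsUnique_path u v
  rw [← sum_darts_sub f p, ← List.sum_toFinset _
    (SimpleGraph.Walk.darts_nodup_of_support_nodup hp.support_nodup), ← Fintype.sum_prod_type',
    ← Finset.sum_filter]
  symm
  refine Finset.sum_bij (fun d _ => (d.fst, d.snd)) ?_ ?_ ?_ ?_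
  · intro d hd
    simpa using crosses_of_mem_darts hp (List.mem_toFinset.1 hd)
  · intro d _ d' _ h
    exact SimpleGraph.Dart.ext _ _ h
  · rintro ⟨x, y⟩ h
    obtain ⟨d, hd, rfl, rfl⟩ := Crosses.exists_mem_darts hH hp (Finset.mem_filter.1 h).2
    exact ⟨d, List.mem_toFinset.2 hd, rfl⟩
  · intros; rfl

theorem reachable_deleteEdges_or {H : SimpleGraph V} (hH : H.IsTree) (u v x : V) :
    (H.deleteEdges {s(u, v)}).Reachable u x ∨ (H.deleteEdges {s(u, v)}).Reachable v x := by
  obtain ⟨p, hp, -⟩ := hH.existsUnique_path u x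
  by_cases he : s(u, v) ∈ p.edges
  · obtain ⟨d, hd, hde⟩ := List.mem_map.1 he
    obtain ⟨-, h1, h2⟩ := crosses_of_mem_darts hp hd
    have hde' : s(d.fst, d.snd) = s(u, v) := hde
    rw [hde'] at h1 h2
    rcases SimpleGraph.dart_edge_eq_mk'_iff'.1 hde with hd' | hd'
    · rw [hd'.2] at h2; exact .inr h2
    · rw [hd'.2] at h2; exact .inl h2
  · exact .inl ⟨p.toDeleteEdge _ he⟩

theorem Crosses.exchange_isTree {H : SimpleGraph V} (hH : H.IsTree) {u v x y : V}
    (h : Crosses H u v x y) :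
    (H.deleteEdges {s(x, y)} ⊔ SimpleGraph.edge u v).IsTree := by
  obtain ⟨hxy, h1, h2⟩ := h
  have hbr := not_reachable_of_isTree hH hxy
  have huv : ¬ (H.deleteEdges {s(x, y)}).Reachable u v :=
    fun h => hbr (h1.symm.trans (h.trans h2.symm))
  have hne : u ≠ v := by rintro rfl; exact huv (.refl _)
  refine ⟨?_, (hH.isAcyclic.anti (H.deleteEdges_le _)).sup_edge_of_not_reachable huv⟩
  have hr {a b : V} (hab : (H.deleteEdges {s(x, y)}).Reachable a b) :
      (H.deleteEdges {s(x, y)} ⊔ SimpleGraph.edge u v).Reachable a b := hab.mono le_sup_left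
  have hu (z : V) : (H.deleteEdges {s(x, y)} ⊔ SimpleGraph.edge u v).Reachable u z := by
    rcases reachable_deleteEdges_or hH x y z with hz | hz
    · exact (hr h1).trans (hr hz)
    · have hadj : (H.deleteEdges {s(x, y)} ⊔ SimpleGraph.edge u v).Adj u v :=
        Or.inr ((SimpleGraph.edge_adj ..).2 ⟨.inl ⟨rfl, rfl⟩, hne⟩)
      exact hadj.reachable.trans ((hr h2.symm).trans (hr hz))
  have := hH.connected.nonempty
  exact ⟨fun a b => (hu a).symm.trans (hu b)⟩

/-- The graph with edge set `T`. -/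
abbrev edgeGraph (T : Finset (Sym2 V)) : SimpleGraph V := SimpleGraph.fromEdgeSet (T : Set (Sym2 V))

theorem edgeGraph_deleteEdges (T : Finset (Sym2 V)) (e : Sym2 V) :
    (edgeGraph T).deleteEdges {e} = edgeGraph (T.erase e) := by
  simp [edgeGraph]

theorem mem_spanningTrees {G : SimpleGraph V} {T : Finset (Sym2 V)} :
    T ∈ spanningTrees G ↔ (T : Set (Sym2 V)) ⊆ G.edgeSet ∧ (edgeGraph T).IsTree := by
  simp [spanningTrees]

theorem edgeGraph_adj {G : SimpleGraph V} {T : Finset (Sym2 V)} (hT : T ∈ spanningTrees G)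
    {x y : V} : (edgeGraph T).Adj x y ↔ s(x, y) ∈ T := by
  rw [edgeGraph, SimpleGraph.fromEdgeSet_adj, Finset.mem_coe]
  exact ⟨And.left, fun h => ⟨h, SimpleGraph.Adj.ne ((mem_spanningTrees.1 hT).1 h)⟩⟩

theorem crosses_edgeGraph {G : SimpleGraph V} {T : Finset (Sym2 V)} (hT : T ∈ spanningTrees G)
    {u v x y : V} : Crosses (edgeGraph T) u v x y ↔ s(x, y) ∈ T ∧
      (edgeGraph (T.erase s(x, y))).Reachable u x ∧ (edgeGraph (T.erase s(x, y))).Reachable y v := by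
  rw [Crosses, edgeGraph_adj hT, edgeGraph_deleteEdges]

/-- Exchange the edge `e` of `T` for `e'`. -/
def exchange (e e' : Sym2 V) (T : Finset (Sym2 V)) : Finset (Sym2 V) := insert e' (T.erase e)

section Exchange

variable {G : SimpleGraph V} {T : Finset (Sym2 V)} {u v x y : V}

theorem notMem_erase_of_crosses (hT : T ∈ spanningTrees G) (huv : G.Adj u v)
    (h : Crosses (edgeGraph T) u v x y) : s(u, v) ∉ T.erase s(x, y) := by
  intro hmem
  have hbr := not_reachable_of_isTree (mem_spanningTrees.1 hT).2 h.1
  have hadj : (edgeGraph (T.erase s(x, y))).Adj u v :=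
    (SimpleGraph.fromEdgeSet_adj _).2 ⟨hmem, huv.ne⟩
  rw [← edgeGraph_deleteEdges] at hadj
  exact hbr (h.2.1.symm.trans (hadj.reachable.trans h.2.2.symm))

theorem erase_exchange (hT : T ∈ spanningTrees G) (huv : G.Adj u v)
    (h : Crosses (edgeGraph T) u v x y) :
    (exchange s(x, y) s(u, v) T).erase s(u, v) = T.erase s(x, y) :=
  Finset.erase_insert (notMem_erase_of_crosses hT huv h)

theorem exchange_exchange (hT : T ∈ spanningTrees G) (huv : G.Adj u v)
    (h : Crosses (edgeGraph T) u v x y) :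
    exchange s(u, v) s(x, y) (exchange s(x, y) s(u, v) T) = T := by
  rw [exchange, erase_exchange hT huv h, Finset.insert_erase ((crosses_edgeGraph hT).1 h).1]

theorem exchange_mem (hT : T ∈ spanningTrees G) (huv : G.Adj u v)
    (h : Crosses (edgeGraph T) u v x y) : exchange s(x, y) s(u, v) T ∈ spanningTrees G := by
  refine mem_spanningTrees.2 ⟨?_, ?_⟩
  · intro e he
    rcases Finset.mem_insert.1 he with rfl | he
    · exact huv
    · exact (mem_spanningTrees.1 hT).1 (Finset.mem_of_mem_erase he)
  · have := h.exchange_isTree (mem_spanningTrees.1 hT).2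
    rw [edgeGraph_deleteEdges, SimpleGraph.edge, ← SimpleGraph.fromEdgeSet_union] at this
    convert this using 2
    simp [exchange, Set.union_comm]

theorem crosses_exchange (hT : T ∈ spanningTrees G) (huv : G.Adj u v)
    (h : Crosses (edgeGraph T) u v x y) :
    Crosses (edgeGraph (exchange s(x, y) s(u, v) T)) x y u v := by
  rw [crosses_edgeGraph (exchange_mem hT huv h), erase_exchange hT huv h]
  obtain ⟨-, h1, h2⟩ := (crosses_edgeGraph hT).1 h
  exact ⟨Finset.mem_insert_self _ _, h1.symm, h2.symm⟩

theorem treeWeight_exchange (c : Sym2 V → ℝ) (hT : T ∈ spanningTrees G) (huv : G.Adj u v)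
    (h : Crosses (edgeGraph T) u v x y) :
    c s(u, v) * treeWeight c T = c s(x, y) * treeWeight c (exchange s(x, y) s(u, v) T) := by
  rw [treeWeight, treeWeight, exchange, Finset.prod_insert (notMem_erase_of_crosses hT huv h),
    ← Finset.mul_prod_erase T c ((crosses_edgeGraph hT).1 h).1]
  ring

end Exchange

open scoped Classical in
/-- The total weight of the spanning trees in which the edge `xy` is crossed from `x` to `y` on the
way from `u` to `v`. -/
def crossWeight (G : SimpleGraph V) (c : Sym2 V → ℝ) (u v x y : V) : ℝ :=
  ∑ T ∈ spanningTrees G with Crosses (edgeGraph T) u v x y, treeWeight c T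

theorem mul_crossWeight {G : SimpleGraph V} (c : Sym2 V → ℝ) {u v x y : V} (huv : G.Adj u v)
    (hxy : G.Adj x y) :
    c s(u, v) * crossWeight G c u v x y = c s(x, y) * crossWeight G c x y u v := by
  classical
  rw [crossWeight, crossWeight, Finset.mul_sum, Finset.mul_sum]
  refine Finset.sum_bij' (fun T _ => exchange s(x, y) s(u, v) T)
    (fun T _ => exchange s(u, v) s(x, y) T) ?_ ?_ ?_ ?_ ?_ <;>
    intro T hT <;> obtain ⟨hT, h⟩ := Finset.mem_filter.1 hT
  · exact Finset.mem_filter.2 ⟨exchange_mem hT huv h, crosses_exchange hT huv h⟩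
  · exact Finset.mem_filter.2 ⟨exchange_mem hT hxy h, crosses_exchange hT hxy h⟩
  · exact exchange_exchange hT huv h
  · exact exchange_exchange hT hxy h
  · exact treeWeight_exchange c hT huv h

/-- The total weight of the spanning trees containing the edge `e`. -/
def edgeWeight (G : SimpleGraph V) (c : Sym2 V → ℝ) (e : Sym2 V) : ℝ :=
  ∑ T ∈ spanningTrees G with e ∈ T, treeWeight c T

open scoped Classical in
/-- The unnormalized potential on `G` for the flow from `u` to `v`: the total weight of the spanning
trees containing `uv` from which deleting `uv` leaves `x` on the side of `u`. -/
def potential (G : SimpleGraph V) (c : Sym2 V → ℝ) (u v x : V) : ℝ :=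
  ∑ T ∈ spanningTrees G with s(u, v) ∈ T ∧ (edgeGraph (T.erase s(u, v))).Reachable u x,
    treeWeight c T

theorem potential_left (G : SimpleGraph V) (c : Sym2 V → ℝ) (u v : V) :
    potential G c u v u = edgeWeight G c s(u, v) := by
  simp [potential, edgeWeight]

theorem potential_right (G : SimpleGraph V) (c : Sym2 V → ℝ) (u v : V) :
    potential G c u v v = 0 := by
  rw [potential, Finset.filter_false_of_mem, Finset.sum_empty]
  rintro T hT ⟨he, h⟩
  rw [← edgeGraph_deleteEdges] at h
  exact not_reachable_of_isTree (mem_spanningTrees.1 hT).2 ((edgeGraph_adj hT).2 he) h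

theorem crossWeight_sub_crossWeight (G : SimpleGraph V) (c : Sym2 V → ℝ) (u v x y : V) :
    crossWeight G c x y u v - crossWeight G c y x u v
      = potential G c u v x - potential G c u v y := by
  classical
  simp only [crossWeight, potential, Finset.sum_filter]
  rw [← Finset.sum_sub_distrib, ← Finset.sum_sub_distrib]
  refine Finset.sum_congr rfl fun T hT => ?_
  simp only [crosses_edgeGraph hT]
  by_cases he : s(u, v) ∈ T
  · have hH := (mem_spanningTrees.1 hT).2
    have hbr := not_reachable_of_isTree hH ((edgeGraph_adj hT).2 he)
    have hside (z : V) : (edgeGraph (T.erase s(u, v))).Reachable v z ↔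
        ¬ (edgeGraph (T.erase s(u, v))).Reachable u z := by
      have hor := reachable_deleteEdges_or hH u v z
      rw [edgeGraph_deleteEdges] at hor hbr
      exact ⟨fun h1 h2 => hbr (h2.trans h1.symm), hor.resolve_left⟩
    simp only [he, true_and, hside, SimpleGraph.reachable_comm (v := u)]
    split_ifs <;> simp_all
  · simp [he]

section Energy

variable (G : SimpleGraph V) [DecidableRel G.Adj] (c : Sym2 V → ℝ)

/-- The conductance between two vertices, zero if they are not adjacent. -/
def cond (x y : V) : ℝ := if G.Adj x y then c s(x, y) else 0

theorem cond_comm (x y : V) : cond G c x y = cond G c y x := by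
  simp [cond, G.adj_comm x y, Sym2.eq_swap (a := x)]

theorem sum_cond (x : V) : ∑ y, cond G c x y = vertCond G c x := by
  simp only [cond, vertCond]
  rw [← Finset.sum_filter]
  refine Finset.sum_congr (by ext; simp) fun y _ => by rw [Sym2.eq_swap]

theorem sum_crossWeight (f : V → ℝ) (u v : V) :
    ∑ x, ∑ y, crossWeight G c u v x y * (f x - f y) = partZ G c * (f u - f v) := by
  classical
  simp only [crossWeight, partZ, Finset.sum_mul, Finset.sum_filter]
  simp_rw [Finset.sum_comm (t := spanningTrees G)]
  refine Finset.sum_congr rfl fun T hT => ?_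
  rw [← sum_crosses (mem_spanningTrees.1 hT).2 f u v, Finset.mul_sum]
  refine Finset.sum_congr rfl fun x _ => ?_
  rw [Finset.mul_sum]
  refine Finset.sum_congr rfl fun y _ => ?_
  split_ifs <;> simp

variable {G}

theorem mul_crossWeight_eq_cond {u v : V} (huv : G.Adj u v) (x y : V) :
    c s(u, v) * crossWeight G c u v x y = cond G c x y * crossWeight G c x y u v := by
  classical
  by_cases hxy : G.Adj x y
  · rw [mul_crossWeight c huv hxy, cond, if_pos hxy]
  · rw [cond, if_neg hxy, crossWeight, Finset.filter_false_of_mem, Finset.sum_empty]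
    · simp
    · intro T hT h
      exact hxy ((mem_spanningTrees.1 hT).1 ((edgeGraph_adj hT).1 h.1))

/-- The Dirichlet form pairs the potential with `f` to give the increment of `f`. -/
theorem sum_cond_potential {u v : V} (huv : G.Adj u v) (f : V → ℝ) :
    ∑ x, ∑ y, cond G c x y * ((potential G c u v x - potential G c u v y) * (f x - f y))
      = 2 * (c s(u, v) * partZ G c * (f u - f v)) := by
  have h1 := sum_crossWeight G c f u v
  have h2 := h1
  rw [Finset.sum_comm] at h2
  calc _ = c s(u, v) * (∑ x, ∑ y, crossWeight G c u v x y * (f x - f y)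
          + ∑ x, ∑ y, crossWeight G c u v y x * (f y - f x)) := by
        rw [← Finset.sum_add_distrib, Finset.mul_sum]
        refine Finset.sum_congr rfl fun x _ => ?_
        rw [← Finset.sum_add_distrib, Finset.mul_sum]
        refine Finset.sum_congr rfl fun y _ => ?_
        have h3 := mul_crossWeight_eq_cond c huv x y
        have h4 := mul_crossWeight_eq_cond c huv y x
        rw [cond_comm G c y x] at h4
        rw [← crossWeight_sub_crossWeight]
        linear_combination (-(f x - f y)) * h3 - (f y - f x) * h4
    _ = _ := by rw [h1, h2]; ring

theorem sum_cond_sub_mul_sub (f g : V → ℝ) :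
    ∑ x, ∑ y, cond G c x y * ((f x - f y) * (g x - g y))
      = 2 * ∑ x, f x * ∑ y, cond G c x y * (g x - g y) := by
  have h : ∑ x, ∑ y, cond G c x y * (f y * (g y - g x))
      = ∑ x, ∑ y, cond G c x y * (f x * (g x - g y)) := by
    rw [Finset.sum_comm]
    simp_rw [cond_comm G c]
  calc _ = ∑ x, ∑ y, cond G c x y * (f x * (g x - g y))
        + ∑ x, ∑ y, cond G c x y * (f y * (g y - g x)) := by
        simp_rw [← Finset.sum_add_distrib]
        refine Finset.sum_congr rfl fun x _ => Finset.sum_congr rfl fun y _ => by ring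
    _ = _ := by
        rw [h, ← two_mul]
        congr 1
        refine Finset.sum_congr rfl fun x _ => ?_
        rw [Finset.mul_sum]
        refine Finset.sum_congr rfl fun y _ => by ring

/-- The Dirichlet energy of `a 1_u - b 1_v`. -/
theorem energy_two_point {u v : V} (huv : G.Adj u v) (a b : ℝ) :
    ∑ x, ∑ y, cond G c x y *
        ((Pi.single u a - Pi.single v b : V → ℝ) x - (Pi.single u a - Pi.single v b : V → ℝ) y) ^ 2
      = 2 * (a ^ 2 * vertCond G c u + b ^ 2 * vertCond G c v + 2 * (a * b) * c s(u, v)) := by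
  have hne := huv.ne
  simp_rw [pow_two (_ - _), sum_cond_sub_mul_sub]
  have hin (x : V) : ∑ y, cond G c x y * ((Pi.single u a - Pi.single v b : V → ℝ) x
      - (Pi.single u a - Pi.single v b : V → ℝ) y)
      = (Pi.single u a - Pi.single v b : V → ℝ) x * vertCond G c x
        - (cond G c x u * a - cond G c x v * b) := by
    simp only [mul_sub, Finset.sum_sub_distrib, ← Finset.sum_mul, sum_cond, Pi.sub_apply]
    simp only [Pi.single_apply, mul_ite, mul_zero, Finset.sum_ite_eq', Finset.mem_univ, if_true]
    split_ifs <;> ring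
  simp_rw [hin]
  simp only [Pi.sub_apply, sub_mul, Finset.sum_sub_distrib]
  simp [Pi.single_apply, hne, hne.symm, cond, huv, huv.symm, Sym2.eq_swap (a := v)]
  ring

/-- Lower bound for the probability that an edge lies in the weighted spanning tree. -/
theorem le_edgeWeight {u v : V} (huv : G.Adj u v) (hc : ∀ e ∈ G.edgeSet, 0 < c e)
    (hZ : 0 < partZ G c) (a b : ℝ) :
    partZ G c * c s(u, v) * (2 * (a + b)
        - (a ^ 2 * vertCond G c u + b ^ 2 * vertCond G c v + 2 * (a * b) * c s(u, v)))
      ≤ edgeWeight G c s(u, v) := by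
  have hne := huv.ne
  have hcZ : 0 < c s(u, v) * partZ G c := mul_pos (hc _ huv) hZ
  set h := potential G c u v with hh
  set g : V → ℝ := Pi.single u a - Pi.single v b with hg
  set t := c s(u, v) * partZ G c with ht
  have h0 : 0 ≤ ∑ x, ∑ y, cond G c x y * ((h x - h y) - t * (g x - g y)) ^ 2 := by
    refine Finset.sum_nonneg fun x _ => Finset.sum_nonneg fun y _ => mul_nonneg ?_ (sq_nonneg _)
    rw [cond]
    split_ifs with hxy
    exacts [(hc _ hxy).le, le_rfl]
  have hexp : ∑ x, ∑ y, cond G c x y * ((h x - h y) - t * (g x - g y)) ^ 2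
      = ∑ x, ∑ y, cond G c x y * ((h x - h y) * (h x - h y))
        - 2 * t * ∑ x, ∑ y, cond G c x y * ((h x - h y) * (g x - g y))
        + t ^ 2 * ∑ x, ∑ y, cond G c x y * (g x - g y) ^ 2 := by
    simp only [Finset.mul_sum, ← Finset.sum_sub_distrib, ← Finset.sum_add_distrib]
    refine Finset.sum_congr rfl fun x _ => Finset.sum_congr rfl fun y _ => by ring
  have hgu : g u - g v = a + b := by simp [hg, hne, hne.symm]
  rw [hexp, hh, sum_cond_potential c huv, sum_cond_potential c huv, potential_left,
    potential_right, hgu, energy_two_point c huv] at h0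
  refine le_of_mul_le_mul_left ?_ hcZ
  linear_combination h0 / 2

end Energy

section Overlap

variable (G : SimpleGraph V) [DecidableRel G.Adj] (c : Sym2 V → ℝ)

theorem subset_edgeFinset {T : Finset (Sym2 V)} (hT : T ∈ spanningTrees G) : T ⊆ G.edgeFinset :=
  fun _ he => SimpleGraph.mem_edgeFinset.2 ((mem_spanningTrees.1 hT).1 he)

theorem card_spanningTree {T : Finset (Sym2 V)} (hT : T ∈ spanningTrees G) :
    T.card + 1 = Fintype.card V := by
  classical
  rw [← (mem_spanningTrees.1 hT).2.card_edgeFinset]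
  congr 2
  ext e
  induction e with
  | h x y => rw [SimpleGraph.mem_edgeFinset, SimpleGraph.mem_edgeSet, edgeGraph_adj hT]

variable {G c} in
theorem treeWeight_pos (hc : ∀ e ∈ G.edgeSet, 0 < c e) {T : Finset (Sym2 V)}
    (hT : T ∈ spanningTrees G) : 0 < treeWeight c T :=
  Finset.prod_pos fun e he => hc e ((mem_spanningTrees.1 hT).1 he)

variable {G c} in
theorem partZ_pos (hG : G.Connected) (hc : ∀ e ∈ G.edgeSet, 0 < c e) : 0 < partZ G c := by
  classical
  obtain ⟨H, hle, hH⟩ := hG.exists_isTree_le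
  refine Finset.sum_pos (fun T hT => treeWeight_pos hc hT) ⟨H.edgeFinset, ?_⟩
  rw [mem_spanningTrees]
  simp [edgeGraph, hle, hH]

variable {G c} in
theorem edgeWeight_nonneg (hc : ∀ e ∈ G.edgeSet, 0 < c e) (e : Sym2 V) : 0 ≤ edgeWeight G c e :=
  Finset.sum_nonneg fun _ hT => (treeWeight_pos hc (Finset.mem_filter.1 hT).1).le

variable {G c} in
theorem edgeWeight_le_partZ (hc : ∀ e ∈ G.edgeSet, 0 < c e) (e : Sym2 V) :
    edgeWeight G c e ≤ partZ G c :=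
  Finset.sum_le_sum_of_subset_of_nonneg (Finset.filter_subset _ _)
    fun _ hT _ => (treeWeight_pos hc hT).le

theorem sum_edgeWeight :
    ∑ e ∈ G.edgeFinset, edgeWeight G c e = partZ G c * (Fintype.card V - 1) := by
  simp only [edgeWeight, Finset.sum_filter, partZ]
  rw [Finset.sum_comm, Finset.sum_mul]
  refine Finset.sum_congr rfl fun T hT => ?_
  rw [← Finset.sum_filter, Finset.filter_mem_eq_inter, Finset.inter_eq_right.2
    (subset_edgeFinset G hT), Finset.sum_const, nsmul_eq_mul, ← card_spanningTree G hT]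
  push_cast
  ring

theorem overlapDet_eq :
    overlapDet G c = ∑ e ∈ G.edgeFinset, (edgeWeight G c e / partZ G c) ^ 2 := by
  simp only [div_pow, ← Finset.sum_div, overlapDet]
  congr 1
  simp only [edgeWeight, Finset.sum_filter, pow_two, Finset.sum_mul_sum]
  symm
  rw [Finset.sum_comm]
  refine Finset.sum_congr rfl fun T hT => ?_
  rw [Finset.sum_comm]
  refine Finset.sum_congr rfl fun T' hT' => ?_
  have h (e : Sym2 V) : ((if e ∈ T then treeWeight c T else 0) *
      if e ∈ T' then treeWeight c T' else 0) =
      if e ∈ T ∩ T' then treeWeight c T * treeWeight c T' else 0 := by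
    simp only [Finset.mem_inter]
    split_ifs <;> simp_all
  simp_rw [h]
  rw [← Finset.sum_filter, Finset.filter_mem_eq_inter, Finset.inter_eq_right.2
    (Finset.inter_subset_left.trans (subset_edgeFinset G hT)), Finset.sum_const, nsmul_eq_mul]
  ring

theorem sum_incident (x : V) :
    ∑ e ∈ G.edgeFinset with x ∈ e, c e = vertCond G c x := by
  symm
  refine Finset.sum_bij (fun y _ => s(y, x)) ?_ ?_ ?_ ?_
  · intro y hy
    simpa [G.adj_comm] using hy
  · intro y _ z _ h
    exact Sym2.congr_left.1 h
  · intro e he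
    obtain ⟨he, hx⟩ := Finset.mem_filter.1 he
    obtain ⟨y, rfl⟩ := Sym2.mem_iff_exists.1 hx
    exact ⟨y, by simpa using he, Sym2.eq_swap⟩
  · intros; rfl

theorem sum_edge_sum_incident (a : V → ℝ) :
    ∑ e ∈ G.edgeFinset, c e * ∑ x with x ∈ e, a x = ∑ x, a x * vertCond G c x := by
  simp_rw [← sum_incident, Finset.mul_sum, Finset.sum_filter]
  rw [Finset.sum_comm]
  refine Finset.sum_congr rfl fun x _ => Finset.sum_congr rfl fun e _ => ?_
  split_ifs <;> ring

theorem sum_mem_edge (a : V → ℝ) {u v : V} (huv : u ≠ v) :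
    ∑ x with x ∈ s(u, v), a x = a u + a v := by
  rw [← Finset.sum_pair huv]
  exact Finset.sum_congr (by ext; simp) fun _ _ => rfl

variable {G c} in
/-- The expected overlap is at most `4 δ |V|`. -/
theorem overlapDet_le (hG : G.Connected) (hc : ∀ e ∈ G.edgeSet, 0 < c e) {γ δ : ℝ} (hγ : 0 < γ)
    (hδ : 0 ≤ δ)
    (hW : (1 - δ) * (Fintype.card V : ℝ)
      ≤ ((Finset.univ.filter fun v : V => γ ≤ vertCond G c v).card : ℝ))
    (hcδ : ∀ e ∈ G.edgeSet, c e ≤ δ * γ) :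
    overlapDet G c ≤ 4 * (δ * (Fintype.card V : ℝ)) := by
  have hZ := partZ_pos hG hc
  let a : V → ℝ := fun x => if γ ≤ vertCond G c x then (vertCond G c x)⁻¹ else 0
  have ha0 (x : V) : 0 ≤ a x := by
    simp only [a]
    split_ifs with h
    exacts [inv_nonneg.2 (hγ.le.trans h), le_rfl]
  have haγ (x : V) : γ * a x ≤ 1 := by
    simp only [a]
    split_ifs with h
    · rw [← div_eq_mul_inv]
      exact (div_le_one (hγ.trans_le h)).2 h
    · simp
  have haC (x : V) : a x * vertCond G c x = if γ ≤ vertCond G c x then 1 else 0 := by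
    simp only [a]
    split_ifs with h
    exacts [inv_mul_cancel₀ (hγ.trans_le h).ne', zero_mul _]
  have haC2 (x : V) : a x ^ 2 * vertCond G c x = a x := by
    rw [pow_two, mul_assoc, haC]
    simp only [a]
    split_ifs <;> simp
  let p : Sym2 V → ℝ := fun e => edgeWeight G c e / partZ G c
  let l : Sym2 V → ℝ := fun e => c e * ∑ x with x ∈ e, a x
  have hl : ∑ e ∈ G.edgeFinset, l e
      = ((Finset.univ.filter fun v : V => γ ≤ vertCond G c v).card : ℝ) := by
    simp only [l, sum_edge_sum_incident, haC, Finset.sum_boole]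
  have hlV : ∑ e ∈ G.edgeFinset, l e ≤ Fintype.card V := by
    rw [hl]
    exact_mod_cast Finset.card_le_univ _
  have hp : ∑ e ∈ G.edgeFinset, p e = Fintype.card V - 1 := by
    simp only [p, ← Finset.sum_div, sum_edgeWeight]
    field_simp
  have hedge : ∀ e ∈ G.edgeFinset, p e ^ 2 ≤ (1 + 2 * δ) * p e - (1 - δ) * l e := by
    intro e he
    rw [SimpleGraph.mem_edgeFinset] at he
    have hp0 : 0 ≤ p e := div_nonneg (edgeWeight_nonneg hc e) hZ.le
    have hp1 : p e ≤ 1 := (div_le_one hZ).2 (edgeWeight_le_partZ hc e)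
    have hce := hc e he
    have hl0 : 0 ≤ l e := mul_nonneg hce.le (Finset.sum_nonneg fun x _ => ha0 x)
    obtain ⟨hl2, hlp⟩ : l e ≤ 2 * δ ∧ l e - l e ^ 2 / 2 ≤ p e := by
      induction e with
      | h u v =>
        have huv : G.Adj u v := he
        have hle := le_edgeWeight c huv hc hZ (a u) (a v)
        have hluv : l s(u, v) = c s(u, v) * (a u + a v) := by
          simp only [l, sum_mem_edge a huv.ne]
        constructor
        · rw [hluv]
          calc c s(u, v) * (a u + a v) ≤ δ * γ * (a u + a v) :=
                mul_le_mul_of_nonneg_right (hcδ _ he) (add_nonneg (ha0 u) (ha0 v))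
            _ = δ * (γ * a u + γ * a v) := by ring
            _ ≤ δ * (1 + 1) := mul_le_mul_of_nonneg_left (add_le_add (haγ u) (haγ v)) hδ
            _ = 2 * δ := by ring
        · rw [haC2, haC2] at hle
          rw [le_div_iff₀ hZ, hluv]
          refine le_trans ?_ hle
          have hsq := mul_nonneg hZ.le (sq_nonneg (c s(u, v) * (a u - a v)))
          linear_combination hsq / 2
    have h1 : 0 ≤ (1 - p e) * (p e - (l e - l e ^ 2 / 2)) :=
      mul_nonneg (sub_nonneg.2 hp1) (sub_nonneg.2 hlp)
    have h2 : 0 ≤ p e * (2 * δ - l e) := mul_nonneg hp0 (sub_nonneg.2 hl2)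
    have h3 : 0 ≤ l e * (2 * δ - l e) := mul_nonneg hl0 (sub_nonneg.2 hl2)
    have h4 : 0 ≤ p e * l e ^ 2 := mul_nonneg hp0 (sq_nonneg _)
    linarith
  rw [overlapDet_eq]
  refine (Finset.sum_le_sum hedge).trans ?_
  rw [Finset.sum_sub_distrib, ← Finset.mul_sum, ← Finset.mul_sum, hp]
  have h5 : δ * ∑ e ∈ G.edgeFinset, l e ≤ δ * Fintype.card V := mul_le_mul_of_nonneg_left hlV hδ
  rw [← hl] at hW
  linarith

end Overlap

/-- Suppose `(Gₙ, cₙ)`, `γₙ > 0`, `δₙ → 0` satisfy Assumption (EO), the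
networks are connected, and the graphs are simple.  Then the expected edge overlap of two
independent weighted spanning trees satisfies `E[|𝒯(cₙ) ∩ 𝒯'(cₙ)|] = O(δₙ)·|V(Gₙ)|`. -/
theorem edge_overlap_det
    (V : ℕ → Type) [∀ n, Fintype (V n)] [∀ n, DecidableEq (V n)]
    (G : ∀ n, SimpleGraph (V n)) [∀ n, DecidableRel (G n).Adj]
    (c : ∀ n, Sym2 (V n) → ℝ) (γ : ℕ → ℝ) (δ : ℕ → ℝ)
    (hconn : ∀ n, (G n).Connected)
    (hpos : ∀ n, ∀ e ∈ (G n).edgeSet, 0 < c n e)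
    (hγ : ∀ n, 0 < γ n)
    (hδ : Tendsto δ atTop (nhds 0))
    -- Assumption (EO)(i): with Wₙ = {v : C_v ≥ γₙ}, |Wₙ| ≥ (1-δₙ)|V(Gₙ)| for all large n
    (hW : ∀ᶠ n in atTop,
      (((Finset.univ.filter fun v : V n => γ n ≤ vertCond (G n) (c n) v).card : ℝ))
        ≥ (1 - δ n) * (Fintype.card (V n) : ℝ))
    -- Assumption (EO)(ii): cₙ(e) ≤ δₙ·γₙ for all edges, for all large n
    (hc : ∀ᶠ n in atTop, ∀ e ∈ (G n).edgeSet, c n e ≤ δ n * γ n) :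
    (fun n => overlapDet (G n) (c n)) =O[atTop] fun n => δ n * (Fintype.card (V n) : ℝ) := by
  refine Asymptotics.IsBigO.of_bound 4 ?_
  filter_upwards [hW, hc] with n hWn hcn
  have h0 : 0 ≤ overlapDet (G n) (c n) := by
    rw [overlapDet_eq]
    exact Finset.sum_nonneg fun _ _ => sq_nonneg _
  rw [Real.norm_of_nonneg h0, norm_mul, Real.norm_eq_abs, Real.norm_natCast]
  refine overlapDet_le (hconn n) (hpos n) (hγ n) (abs_nonneg _) (le_trans ?_ hWn) fun e he =>
    (hcn e he).trans (mul_le_mul_of_nonneg_right (le_abs_self _) (hγ n).le)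
  exact mul_le_mul_of_nonneg_right (sub_le_sub_left (le_abs_self _) _) (Nat.cast_nonneg _)

end WSTPaper
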